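/- arXiv:1712.09499 — 3 statements merged into one kernel-verified Lean document; each statement's English description precedes it below -/
import Mathlib

section
/- Let A ⊆ C and B ⊆ D be unital inclusions of unital C*-algebras which are strongly Morita equivalent with respect to a C–D-equivalence bimodule Y and its closed subspace X. Suppose A' ∩ C = C·1 and that E^A: C → A and E^B: D → B are conditional expectations of Watatani index-finite type. Then there is a unique conditional expectation E^X from Y onto X with respect to E^A and E^B. -/
open scoped MultiplierAlgebra

noncomputable section

structure EquivBimodule (C D Y : Type*)
    [NonUnitalCStarAlgebra C] [PartialOrder C] [StarOrderedRing C]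
    [NonUnitalCStarAlgebra D] [PartialOrder D] [StarOrderedRing D]
    [NormedAddCommGroup Y] [NormedSpace ℂ Y] [CompleteSpace Y] : Type _ where
  lsmul : C → Y → Y
  rsmul : Y → D → Y
  linn : Y → Y → C
  rinn : Y → Y → D
  lsmul_add : ∀ c x y, lsmul c (x + y) = lsmul c x + lsmul c y
  add_lsmul : ∀ c c' x, lsmul (c + c') x = lsmul c x + lsmul c' x
  mul_lsmul : ∀ c c' x, lsmul (c * c') x = lsmul c (lsmul c' x)
  smul_lsmul : ∀ (z : ℂ) c x, lsmul (z • c) x = z • lsmul c x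
  lsmul_smul : ∀ (z : ℂ) c x, lsmul c (z • x) = z • lsmul c x
  add_rsmul : ∀ x y d, rsmul (x + y) d = rsmul x d + rsmul y d
  rsmul_add : ∀ x d d', rsmul x (d + d') = rsmul x d + rsmul x d'
  rsmul_mul : ∀ x d d', rsmul x (d * d') = rsmul (rsmul x d) d'
  rsmul_smul : ∀ (z : ℂ) x d, rsmul (z • x) d = z • rsmul x d
  smul_rsmul : ∀ (z : ℂ) x d, rsmul x (z • d) = z • rsmul x d
  lsmul_rsmul : ∀ c x d, rsmul (lsmul c x) d = lsmul c (rsmul x d)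
  linn_add_left : ∀ x y z, linn (x + y) z = linn x z + linn y z
  linn_smul_left : ∀ (t : ℂ) x y, linn (t • x) y = t • linn x y
  linn_star : ∀ x y, star (linn x y) = linn y x
  linn_lsmul_left : ∀ c x y, linn (lsmul c x) y = c * linn x y
  linn_nonneg : ∀ x, 0 ≤ linn x x
  linn_definite : ∀ x, linn x x = 0 → x = 0
  rinn_add_right : ∀ x y z, rinn x (y + z) = rinn x y + rinn x z
  rinn_smul_right : ∀ (t : ℂ) x y, rinn x (t • y) = t • rinn x y
  rinn_star : ∀ x y, star (rinn x y) = rinn y x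
  rinn_rsmul_right : ∀ x y d, rinn x (rsmul y d) = rinn x y * d
  rinn_nonneg : ∀ x, 0 ≤ rinn x x
  rinn_definite : ∀ x, rinn x x = 0 → x = 0
  imprimitivity : ∀ x y z, lsmul (linn x y) z = rsmul x (rinn y z)
  norm_linn : ∀ x, ‖linn x x‖ = ‖x‖ ^ 2
  norm_rinn : ∀ x, ‖rinn x x‖ = ‖x‖ ^ 2
  full_left : Dense (Submodule.span ℂ {c : C | ∃ x y, c = linn x y} : Set C)
  full_right : Dense (Submodule.span ℂ {d : D | ∃ x y, d = rinn x y} : Set D)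

namespace EquivBimodule

variable {C D Y W : Type*}
    [NonUnitalCStarAlgebra C] [PartialOrder C] [StarOrderedRing C]
    [NonUnitalCStarAlgebra D] [PartialOrder D] [StarOrderedRing D]
    [NormedAddCommGroup Y] [NormedSpace ℂ Y] [CompleteSpace Y]
    [NormedAddCommGroup W] [NormedSpace ℂ W] [CompleteSpace W]

structure Iso (E : EquivBimodule C D Y) (F : EquivBimodule C D W) where
  toEquiv : Y ≃ₗ[ℂ] W
  map_lsmul : ∀ c y, toEquiv (E.lsmul c y) = F.lsmul c (toEquiv y)
  map_rsmul : ∀ y d, toEquiv (E.rsmul y d) = F.rsmul (toEquiv y) d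
  map_linn : ∀ x y, F.linn (toEquiv x) (toEquiv y) = E.linn x y
  map_rinn : ∀ x y, F.rinn (toEquiv x) (toEquiv y) = E.rinn x y

end EquivBimodule

def DenseIncl {A C : Type*} [NonUnitalCStarAlgebra C] (ι : A → C) : Prop :=
  Dense (Submodule.span ℂ {x : C | ∃ (a : A) (c : C), x = ι a * c} : Set C)

structure IsMoritaIncl {A B C D Y : Type*}
    [NonUnitalCStarAlgebra C] [PartialOrder C] [StarOrderedRing C]
    [NonUnitalCStarAlgebra D] [PartialOrder D] [StarOrderedRing D]
    [NormedAddCommGroup Y] [NormedSpace ℂ Y] [CompleteSpace Y]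
    (ιA : A → C) (ιB : B → D)
    (E : EquivBimodule C D Y) (X : Submodule ℂ Y) : Prop where
  closed : IsClosed (X : Set Y)
  lsmul_mem : ∀ (a : A), ∀ x ∈ X, E.lsmul (ιA a) x ∈ X
  rsmul_mem : ∀ (b : B), ∀ x ∈ X, E.rsmul x (ιB b) ∈ X
  linn_mem : ∀ x ∈ X, ∀ y ∈ X, E.linn x y ∈ Set.range ιA
  rinn_mem : ∀ x ∈ X, ∀ y ∈ X, E.rinn x y ∈ Set.range ιB
  span_XX_left :
    closure (Submodule.span ℂ {c : C | ∃ x ∈ X, ∃ y ∈ X, c = E.linn x y} : Set C) = Set.range ιA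
  span_YX_left :
    Dense (Submodule.span ℂ {c : C | ∃ (y : Y), ∃ x ∈ X, c = E.linn y x} : Set C)
  span_XX_right :
    closure (Submodule.span ℂ {d : D | ∃ x ∈ X, ∃ y ∈ X, d = E.rinn x y} : Set D) = Set.range ιB
  span_YX_right :
    Dense (Submodule.span ℂ {d : D | ∃ (y : Y), ∃ x ∈ X, d = E.rinn y x} : Set D)

abbrev IsEquiPair {A C Y : Type*}
    [NonUnitalCStarAlgebra C] [PartialOrder C] [StarOrderedRing C]
    [NormedAddCommGroup Y] [NormedSpace ℂ Y] [CompleteSpace Y]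
    (ι : A → C) (E : EquivBimodule C C Y) (X : Submodule ℂ Y) : Prop :=
  IsMoritaIncl ι ι E X

def PairEquiv {C D Y W : Type*}
    [NonUnitalCStarAlgebra C] [PartialOrder C] [StarOrderedRing C]
    [NonUnitalCStarAlgebra D] [PartialOrder D] [StarOrderedRing D]
    [NormedAddCommGroup Y] [NormedSpace ℂ Y] [CompleteSpace Y]
    [NormedAddCommGroup W] [NormedSpace ℂ W] [CompleteSpace W]
    (E : EquivBimodule C D Y) (X : Submodule ℂ Y)
    (F : EquivBimodule C D W) (Z : Submodule ℂ W) : Prop :=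
  ∃ Φ : E.Iso F, X.map Φ.toEquiv.toLinearMap = Z

def IsTrivialData {C : Type*}
    [NonUnitalCStarAlgebra C] [PartialOrder C] [StarOrderedRing C]
    (T : EquivBimodule C C C) : Prop :=
  T.lsmul = (fun c x => c * x) ∧ T.rsmul = (fun x c => x * c) ∧
    T.linn = (fun x y => x * star y) ∧ T.rinn = (fun x y => star x * y)

/-- The data of the equivalence bimodule `Y_σ` induced by an automorphism with
underlying map `σ` (with inverse `σinv`). -/
def IsAlphaData {C : Type*}
    [NonUnitalCStarAlgebra C] [PartialOrder C] [StarOrderedRing C]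
    (σ σinv : C → C) (T : EquivBimodule C C C) : Prop :=
  T.lsmul = (fun c x => c * x) ∧ T.rsmul = (fun x c => x * σ c) ∧
    T.linn = (fun x y => x * star y) ∧ T.rinn = (fun x y => σinv (star x * y))

/-- The submodule `{ι a | a : A}` of `C`, e.g. the subspace `X_α = A` of `Y_α = C`. -/
def rangeSub {A C : Type*} [NonUnitalCStarAlgebra C]
    (ι : A → C) : Submodule ℂ C :=
  Submodule.span ℂ (Set.range ι)

/-- A realization of the interior tensor product `Y ⊗_D W` of equivalence bimodules. -/
structure IsTensorProd {C D L Y W V : Type*}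
    [NonUnitalCStarAlgebra C] [PartialOrder C] [StarOrderedRing C]
    [NonUnitalCStarAlgebra D] [PartialOrder D] [StarOrderedRing D]
    [NonUnitalCStarAlgebra L] [PartialOrder L] [StarOrderedRing L]
    [NormedAddCommGroup Y] [NormedSpace ℂ Y] [CompleteSpace Y]
    [NormedAddCommGroup W] [NormedSpace ℂ W] [CompleteSpace W]
    [NormedAddCommGroup V] [NormedSpace ℂ V] [CompleteSpace V]
    (E : EquivBimodule C D Y) (G : EquivBimodule D L W)
    (F : EquivBimodule C L V) (s : Y → W → V) : Prop where
  add_left : ∀ y y' w, s (y + y') w = s y w + s y' w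
  smul_left : ∀ (z : ℂ) y w, s (z • y) w = z • s y w
  add_right : ∀ y w w', s y (w + w') = s y w + s y w'
  smul_right : ∀ (z : ℂ) y w, s y (z • w) = z • s y w
  balanced : ∀ y d w, s (E.rsmul y d) w = s y (G.lsmul d w)
  map_lsmul : ∀ c y w, F.lsmul c (s y w) = s (E.lsmul c y) w
  map_rsmul : ∀ y w l, F.rsmul (s y w) l = s y (G.rsmul w l)
  map_linn : ∀ y y' w w',
    F.linn (s y w) (s y' w') = E.linn (E.rsmul y (G.linn w w')) y'
  map_rinn : ∀ y y' w w',
    F.rinn (s y w) (s y' w') = G.rinn w (G.lsmul (E.rinn y y') w')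
  dense : Dense (Submodule.span ℂ {v : V | ∃ y w, v = s y w} : Set V)

/-- A realization of the product of two elements of `Equi(A, C)`:
the tensor product bimodule together with the distinguished subspace `X₁ ⊗ X₂`. -/
structure IsPairTensor {A C Y W V : Type*}
    [NonUnitalCStarAlgebra C] [PartialOrder C] [StarOrderedRing C]
    [NormedAddCommGroup Y] [NormedSpace ℂ Y] [CompleteSpace Y]
    [NormedAddCommGroup W] [NormedSpace ℂ W] [CompleteSpace W]
    [NormedAddCommGroup V] [NormedSpace ℂ V] [CompleteSpace V]
    (ι : A → C)
    (E₁ : EquivBimodule C C Y) (X₁ : Submodule ℂ Y)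
    (E₂ : EquivBimodule C C W) (X₂ : Submodule ℂ W)
    (G : EquivBimodule C C V) (XV : Submodule ℂ V) (s : Y → W → V) : Prop where
  tensor : IsTensorProd E₁ E₂ G s
  sub : (XV : Set V) =
    closure (Submodule.span ℂ {v : V | ∃ x ∈ X₁, ∃ z ∈ X₂, v = s x z} : Set V)

section Multiplier

variable {C : Type*} [NonUnitalCStarAlgebra C]

/-- Conjugation `c ↦ u c u*` by a (unitary) multiplier `u ∈ M(C)`. -/
def mAd (u : 𝓜(ℂ, C)) (c : C) : C := u.fst ((star u).snd c)

/-- `m ∈ M(C)` is (the extension of) a multiplier of the subalgebra `A` (realized by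
`ι : A → C`): it maps `A` into `A` on both sides.  When `AC` is dense in `C`, the
multiplier algebra `M(A)` is exactly the set of such multipliers. -/
def IsMultiplierOf {A : Type*} (ι : A → C) (m : 𝓜(ℂ, C)) : Prop :=
  (∀ a : A, m.fst (ι a) ∈ Set.range ι) ∧ (∀ a : A, m.snd (ι a) ∈ Set.range ι)

/-- `u ∈ K(M(C))`: a unitary multiplier with `u a u*, u* a u ∈ A` for all `a ∈ A`. -/
def mem_KMC {A : Type*} (ι : A → C) (u : 𝓜(ℂ, C)) : Prop :=
  u ∈ unitary 𝓜(ℂ, C) ∧ (∀ a : A, mAd u (ι a) ∈ Set.range ι) ∧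
    (∀ a : A, mAd (star u) (ι a) ∈ Set.range ι)

/-- The subspace `Au = {a u | a ∈ A}` of `C`, for a multiplier `u ∈ M(C)`. -/
def AuSub {A : Type*} (ι : A → C) (u : 𝓜(ℂ, C)) : Submodule ℂ C :=
  Submodule.span ℂ {x : C | ∃ a : A, x = u.snd (ι a)}

end Multiplier

/-- A positive element `h` with `hA` dense in `A`; a C*-algebra is σ-unital iff it
possesses such a (strictly positive) element. -/
def SigmaUnital (A : Type*) [NonUnitalCStarAlgebra A] [PartialOrder A]
    [StarOrderedRing A] : Prop :=
  ∃ h : A, 0 ≤ h ∧ Dense (Set.range fun a : A => h * a)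

/-- A system of matrix units over `C` realizing `Cs` as the stabilization `C ⊗ K`. -/
structure IsStabilization {C Cs : Type*} [NonUnitalCStarAlgebra C]
    [NonUnitalCStarAlgebra Cs] (e : ℕ → ℕ → C → Cs) : Prop where
  map_add : ∀ i j c c', e i j (c + c') = e i j c + e i j c'
  map_smul : ∀ i j (z : ℂ) c, e i j (z • c) = z • e i j c
  map_mul : ∀ i j k l c d, e i j c * e k l d = if j = k then e i l (c * d) else 0
  map_star : ∀ i j c, star (e i j c) = e j i (star c)
  isometry : ∀ i j c, ‖e i j c‖ = ‖c‖
  dense : Dense (Submodule.span ℂ {x : Cs | ∃ i j c, x = e i j c} : Set Cs)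

section Unital

variable {A B C D : Type*} [CStarAlgebra A] [CStarAlgebra B] [CStarAlgebra C] [CStarAlgebra D]
  [PartialOrder C] [StarOrderedRing C] [PartialOrder D] [StarOrderedRing D]

/-- A conditional expectation from `C` onto `A`, for a unital inclusion realized by
`ι : A →⋆ₐ[ℂ] C`. -/
structure CondExpectation [PartialOrder A] [StarOrderedRing A] (ι : A →⋆ₐ[ℂ] C) where
  toFun : C → A
  map_add : ∀ x y, toFun (x + y) = toFun x + toFun y
  map_smul : ∀ (z : ℂ) x, toFun (z • x) = z • toFun x
  map_star : ∀ x, toFun (star x) = star (toFun x)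
  retraction : ∀ a, toFun (ι a) = a
  left_mod : ∀ a c, toFun (ι a * c) = a * toFun c
  right_mod : ∀ c a, toFun (c * ι a) = toFun c * a
  pos : ∀ c, 0 ≤ toFun (star c * c)

/-- A quasi-basis for a conditional expectation, in the sense of Watatani. -/
def IsQuasiBasis [PartialOrder A] [StarOrderedRing A] {ι : A →⋆ₐ[ℂ] C}
    (E : CondExpectation ι) {n : ℕ} (u : Fin n → C) : Prop :=
  ∀ c : C, (∑ i, u i * ι (E.toFun (star (u i) * c)) = c) ∧
    (∑ i, ι (E.toFun (c * u i)) * star (u i) = c)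

/-- A conditional expectation is of Watatani index-finite type if it admits a
quasi-basis. -/
def FiniteIndex [PartialOrder A] [StarOrderedRing A] {ι : A →⋆ₐ[ℂ] C}
    (E : CondExpectation ι) : Prop :=
  ∃ (n : ℕ) (u : Fin n → C), IsQuasiBasis E u

/-- `A' ∩ C = ℂ 1` for the inclusion realized by `ι`. -/
def IrreducibleIncl (ι : A →⋆ₐ[ℂ] C) : Prop :=
  ∀ c : C, (∀ a : A, ι a * c = c * ι a) → ∃ z : ℂ, c = z • (1 : C)

variable [PartialOrder A] [StarOrderedRing A] [PartialOrder B] [StarOrderedRing B]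

/-- A conditional expectation `E^X : Y → X` with respect to `E^A` and `E^B`
(Definition 2.4 of [KT4]). -/
structure IsBimodCondExp {Y : Type*}
    [NormedAddCommGroup Y] [NormedSpace ℂ Y] [CompleteSpace Y]
    (ιA : A →⋆ₐ[ℂ] C) (ιB : B →⋆ₐ[ℂ] D)
    (EA : CondExpectation ιA) (EB : CondExpectation ιB)
    (EY : EquivBimodule C D Y) (X : Submodule ℂ Y) (EX : Y → Y) : Prop where
  map_add : ∀ y y', EX (y + y') = EX y + EX y'
  map_smul : ∀ (z : ℂ) y, EX (z • y) = z • EX y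
  mem : ∀ y, EX y ∈ X
  cond1 : ∀ (c : C), ∀ x ∈ X, EX (EY.lsmul c x) = EY.lsmul (ιA (EA.toFun c)) x
  cond2 : ∀ (a : A) (y : Y), EX (EY.lsmul (ιA a) y) = EY.lsmul (ιA a) (EX y)
  cond3 : ∀ (y : Y), ∀ x ∈ X, ιA (EA.toFun (EY.linn y x)) = EY.linn (EX y) x
  cond4 : ∀ (d : D), ∀ x ∈ X, EX (EY.rsmul x d) = EY.rsmul x (ιB (EB.toFun d))
  cond5 : ∀ (b : B) (y : Y), EX (EY.rsmul y (ιB b)) = EY.rsmul (EX y) (ιB b)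
  cond6 : ∀ (y : Y), ∀ x ∈ X, ιB (EB.toFun (EY.rinn y x)) = EY.rinn (EX y) x

/-- The C*-basic construction `C₁` for a conditional expectation `E : C → A`,
realized by a unital embedding `ιC : C →⋆ₐ[ℂ] C₁` and the Jones projection `e`. -/
structure IsBasicConstruction {A C C₁ : Type*} [CStarAlgebra A] [CStarAlgebra C]
    [CStarAlgebra C₁] [PartialOrder A] [StarOrderedRing A]
    [PartialOrder C] [StarOrderedRing C]
    (ι : A →⋆ₐ[ℂ] C) (E : CondExpectation ι)
    (ιC : C →⋆ₐ[ℂ] C₁) (e : C₁) : Prop where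
  inj : Function.Injective ιC
  idem : e * e = e
  selfadj : star e = e
  comm : ∀ a : A, ιC (ι a) * e = e * ιC (ι a)
  expect : ∀ c : C, e * ιC c * e = ιC (ι (E.toFun c)) * e
  faithful : ∀ c : C, ιC c * e = 0 → c = 0
  span : ∀ x : C₁, x ∈ Submodule.span ℂ {z : C₁ | ∃ c d : C, z = ιC c * e * ιC d}

end Unital

/-- `M` is the `A–B`-equivalence bimodule obtained by restricting the operations of the
`C–D`-equivalence bimodule `EY` to the closed subspace `X` (whose inner products on `X`
take values in the subalgebras realized by `ιA`, `ιB`). -/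
structure IsRestriction {A B C D Y : Type*}
    [NonUnitalCStarAlgebra A] [PartialOrder A] [StarOrderedRing A]
    [NonUnitalCStarAlgebra B] [PartialOrder B] [StarOrderedRing B]
    [NonUnitalCStarAlgebra C] [PartialOrder C] [StarOrderedRing C]
    [NonUnitalCStarAlgebra D] [PartialOrder D] [StarOrderedRing D]
    [NormedAddCommGroup Y] [NormedSpace ℂ Y] [CompleteSpace Y]
    (ιA : A → C) (ιB : B → D)
    (EY : EquivBimodule C D Y) (X : Submodule ℂ Y) [CompleteSpace X]
    (M : EquivBimodule A B X) : Prop where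
  lsmul_coe : ∀ (a : A) (x : X), (M.lsmul a x : Y) = EY.lsmul (ιA a) (x : Y)
  rsmul_coe : ∀ (x : X) (b : B), (M.rsmul x b : Y) = EY.rsmul (x : Y) (ιB b)
  linn_coe : ∀ x y : X, ιA (M.linn x y) = EY.linn (x : Y) (y : Y)
  rinn_coe : ∀ x y : X, ιB (M.rinn x y) = EY.rinn (x : Y) (y : Y)

section Upward

variable {A B C D C₁ D₁ : Type*} [CStarAlgebra A] [CStarAlgebra B] [CStarAlgebra C]
  [CStarAlgebra D] [CStarAlgebra C₁] [CStarAlgebra D₁]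
  [PartialOrder A] [StarOrderedRing A] [PartialOrder B] [StarOrderedRing B]
  [PartialOrder C] [StarOrderedRing C] [PartialOrder D] [StarOrderedRing D]
  [PartialOrder C₁] [StarOrderedRing C₁] [PartialOrder D₁] [StarOrderedRing D₁]

/-- A realization of the upward basic construction `C ⊗_A X ⊗_B D̃` as a
`C₁–D₁`-equivalence bimodule, where `M` is the middle `A–B`-equivalence bimodule
(`X` regarded as an `A–B`-bimodule), together with the canonical trilinear map `t`
(the map `(c, x, d) ↦ c ⊗ x ⊗ d̃`, conjugate-linear in the last variable). -/
structure IsUpwardBasic {Xc T : Type*}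
    [NormedAddCommGroup Xc] [NormedSpace ℂ Xc] [CompleteSpace Xc]
    [NormedAddCommGroup T] [NormedSpace ℂ T] [CompleteSpace T]
    (ιA : A →⋆ₐ[ℂ] C) (ιB : B →⋆ₐ[ℂ] D)
    (EA : CondExpectation ιA) (EB : CondExpectation ιB)
    (M : EquivBimodule A B Xc)
    (ιC : C →⋆ₐ[ℂ] C₁) (eA : C₁) (ιD : D →⋆ₐ[ℂ] D₁) (eB : D₁)
    (F : EquivBimodule C₁ D₁ T) (t : C → Xc → D → T) : Prop where
  add₁ : ∀ c c' x d, t (c + c') x d = t c x d + t c' x d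
  smul₁ : ∀ (z : ℂ) c x d, t (z • c) x d = z • t c x d
  add₂ : ∀ c x x' d, t c (x + x') d = t c x d + t c x' d
  smul₂ : ∀ (z : ℂ) c x d, t c (z • x) d = z • t c x d
  add₃ : ∀ c x d d', t c x (d + d') = t c x d + t c x d'
  smul₃ : ∀ (z : ℂ) c x d, t c x (z • d) = (starRingEnd ℂ z) • t c x d
  balanced₁ : ∀ (a : A) c x d, t (c * ιA a) x d = t c (M.lsmul a x) d
  balanced₂ : ∀ (b : B) c x d, t c (M.rsmul x b) d = t c x (d * ιB (star b))
  map_lsmul : ∀ c' c x d, F.lsmul (ιC c') (t c x d) = t (c' * c) x d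
  map_eA : ∀ c x d, F.lsmul eA (t c x d) = t (ιA (EA.toFun c)) x d
  map_rsmul : ∀ c x d d', F.rsmul (t c x d) (ιD d') = t c x (star d' * d)
  map_eB : ∀ c x d, F.rsmul (t c x d) eB = t c x (ιB (EB.toFun d))
  linn_eq : ∀ c c' x x' d d',
    F.linn (t c x d) (t c' x' d') =
      ιC (c * ιA (M.linn (M.rsmul x (EB.toFun (star d * d'))) x')) * eA * ιC (star c')
  rinn_eq : ∀ c c' x x' d d',
    F.rinn (t c x d) (t c' x' d') =
      ιD d * eB * ιD (ιB (M.rinn x (M.lsmul (EA.toFun (star c * c')) x')) * star d')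
  dense : Dense (Submodule.span ℂ {v : T | ∃ c x d, v = t c x d} : Set T)

end Upward



namespace EquivBimodule

variable {C D Y : Type*} [CStarAlgebra C] [PartialOrder C] [StarOrderedRing C]
  [CStarAlgebra D] [PartialOrder D] [StarOrderedRing D]
  [NormedAddCommGroup Y] [NormedSpace ℂ Y] [CompleteSpace Y] (E : EquivBimodule C D Y)

theorem rsmul_sum' {n : ℕ} (y : Y) (d : Fin n → D) :
    E.rsmul y (∑ i, d i) = ∑ i, E.rsmul y (d i) :=
  map_sum (AddMonoidHom.mk' (E.rsmul y) (E.rsmul_add y)) d Finset.univ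

theorem sum_rsmul' {n : ℕ} (y : Fin n → Y) (d : D) :
    E.rsmul (∑ i, y i) d = ∑ i, E.rsmul (y i) d :=
  map_sum (AddMonoidHom.mk' (fun y => E.rsmul y d) (fun a b => E.add_rsmul a b d)) y Finset.univ

theorem lsmul_sum' {n : ℕ} (c : C) (y : Fin n → Y) :
    E.lsmul c (∑ i, y i) = ∑ i, E.lsmul c (y i) :=
  map_sum (AddMonoidHom.mk' (E.lsmul c) (E.lsmul_add c)) y Finset.univ

theorem sum_lsmul' {n : ℕ} (c : Fin n → C) (y : Y) :
    E.lsmul (∑ i, c i) y = ∑ i, E.lsmul (c i) y :=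
  map_sum (AddMonoidHom.mk' (fun c => E.lsmul c y) (fun a b => E.add_lsmul a b y)) c Finset.univ

theorem sum_linn' {n : ℕ} (y : Fin n → Y) (w : Y) :
    E.linn (∑ i, y i) w = ∑ i, E.linn (y i) w :=
  map_sum (AddMonoidHom.mk' (fun y => E.linn y w) (fun a b => E.linn_add_left a b w)) y Finset.univ

theorem one_lsmul' (y : Y) : E.lsmul 1 y = y := by
  have h : ∀ w, E.linn (E.lsmul 1 y - y) w = 0 := by
    intro w
    have := (AddMonoidHom.mk' (fun y => E.linn y w)
      (fun a b => E.linn_add_left a b w)).map_sub (E.lsmul 1 y) y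
    simp only [AddMonoidHom.mk'_apply] at this
    rw [this, E.linn_lsmul_left, one_mul, sub_self]
  exact sub_eq_zero.1 (E.linn_definite _ (h _))

theorem rsmul_one' (y : Y) : E.rsmul y 1 = y := by
  have h : ∀ w, E.rinn w (E.rsmul y 1 - y) = 0 := by
    intro w
    have := (AddMonoidHom.mk' (fun y => E.rinn w y)
      (fun a b => E.rinn_add_right w a b)).map_sub (E.rsmul y 1) y
    simp only [AddMonoidHom.mk'_apply] at this
    rw [this, E.rinn_rsmul_right, mul_one, sub_self]
  exact sub_eq_zero.1 (E.rinn_definite _ (h _))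

end EquivBimodule

theorem CondExpectation.map_sum' {A C : Type*} [CStarAlgebra A] [CStarAlgebra C]
    [PartialOrder A] [StarOrderedRing A] {ι : A →⋆ₐ[ℂ] C} (E : CondExpectation ι)
    {n : ℕ} (c : Fin n → C) : E.toFun (∑ i, c i) = ∑ i, E.toFun (c i) :=
  map_sum (AddMonoidHom.mk' E.toFun E.map_add) c Finset.univ

/-- In an irreducible inclusion, an expectation with a quasi-basis is the only unital
bimodule projection. -/
theorem condExp_unique_of_irreducible {B D : Type*} [CStarAlgebra B] [CStarAlgebra D]
    [PartialOrder B] [StarOrderedRing B] {ι : B →⋆ₐ[ℂ] D} (E : CondExpectation ι)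
    {n : ℕ} (u : Fin n → D) (hu : IsQuasiBasis E u) (hirr : IrreducibleIncl ι)
    (F : D → B) (hadd : ∀ d d', F (d + d') = F d + F d')
    (hl : ∀ b d, F (ι b * d) = b * F d) (hr : ∀ d b, F (d * ι b) = F d * b)
    (h1 : F 1 = 1) (d : D) : F d = E.toFun d := by
  set h : D := ∑ i, ι (F (u i)) * star (u i) with hh
  have hF : ∀ d, F d = E.toFun (h * d) := by
    intro d
    conv_lhs => rw [← (hu d).1]
    have hs : ∀ g : Fin n → D, F (∑ i, g i) = ∑ i, F (g i) := fun g =>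
      map_sum (AddMonoidHom.mk' F hadd) g Finset.univ
    rw [hs, hh, Finset.sum_mul, E.map_sum']
    refine Finset.sum_congr rfl fun i _ => ?_
    rw [hr, mul_assoc, E.left_mod]
  have hext : ∀ k k' : D, (∀ d, E.toFun (k * d) = E.toFun (k' * d)) → k = k' := by
    intro k k' hk
    rw [← (hu k).2, ← (hu k').2]
    exact Finset.sum_congr rfl fun i _ => by rw [hk]
  obtain ⟨t, ht⟩ := hirr h (by
    intro b
    apply hext
    intro d
    rw [mul_assoc, mul_assoc, E.left_mod, ← hF, ← hF, hl])
  have hFt : ∀ d, F d = t • E.toFun d := by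
    intro d
    rw [hF, ht, smul_mul_assoc, one_mul, E.map_smul]
  have hE1 : E.toFun 1 = 1 := by
    have := E.retraction 1
    rwa [map_one] at this
  have ht1 : t • (1 : B) = 1 := by
    have := hFt 1
    rw [h1, hE1] at this
    exact this.symm
  calc F d = t • E.toFun d := hFt d
    _ = (t • (1 : B)) * E.toFun d := by rw [smul_mul_assoc, one_mul]
    _ = E.toFun d := by rw [ht1, one_mul]

theorem exists_unit_near_one {B D : Type*} [CStarAlgebra B] [CStarAlgebra D]
    (ι : B →⋆ₐ[ℂ] D) (hι : Function.Injective ι) (S : Submodule ℂ D)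
    (hS : closure (S : Set D) = Set.range ι) : ∃ (s : D) (b : B), s ∈ S ∧ s * ι b = 1 ∧
      ι b * s = 1 := by
  have h1 : (1 : D) ∈ closure (S : Set D) := by rw [hS]; exact ⟨1, map_one ι⟩
  obtain ⟨s, hs, hd⟩ := Metric.mem_closure_iff.1 h1 1 one_pos
  have : s ∈ Set.range ι := by rw [← hS]; exact subset_closure hs
  obtain ⟨b, rfl⟩ := this
  have hn : ‖1 - b‖ < 1 := by
    rw [← NonUnitalStarAlgHom.norm_map ι hι (1 - b), map_sub, map_one, ← dist_eq_norm]
    exact hd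
  have hu : IsUnit b := by
    have := isUnit_one_sub_of_norm_lt_one hn
    rwa [sub_sub_cancel] at this
  obtain ⟨v, rfl⟩ := hu
  refine ⟨_, ↑v⁻¹, hs, ?_, ?_⟩ <;> rw [← map_mul] <;> simp

section

variable {A B C D Y : Type*} [CStarAlgebra A] [CStarAlgebra B] [CStarAlgebra C] [CStarAlgebra D]
    [PartialOrder C] [StarOrderedRing C] [PartialOrder D] [StarOrderedRing D]
    [NormedAddCommGroup Y] [NormedSpace ℂ Y] [CompleteSpace Y]

theorem IsMoritaIncl.right_unit (ιA : A →⋆ₐ[ℂ] C) (ιB : B →⋆ₐ[ℂ] D)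
    (hιB : Function.Injective ιB) {EY : EquivBimodule C D Y} {X : Submodule ℂ Y}
    (hmor : IsMoritaIncl ⇑ιA ⇑ιB EY X) :
    ∃ (n : ℕ) (z x : Fin n → Y), (∀ i, z i ∈ X) ∧ (∀ i, x i ∈ X) ∧
      ∑ i, EY.rinn (z i) (x i) = 1 := by
  obtain ⟨s, b, hs, hsb, -⟩ := exists_unit_near_one ιB hιB _ hmor.span_XX_right
  obtain ⟨n, f, g, hfg⟩ := Submodule.mem_span_set'.1 hs
  choose z hz x hx hg using fun i => (g i).2
  refine ⟨n, z, fun i => EY.rsmul (f i • x i) (ιB b), hz,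
    fun i => hmor.rsmul_mem _ _ (X.smul_mem _ (hx i)), ?_⟩
  simp only [EY.rinn_rsmul_right, EY.rinn_smul_right, ← hg]
  rw [← Finset.sum_mul, hfg, hsb]

theorem IsMoritaIncl.left_unit (ιA : A →⋆ₐ[ℂ] C) (ιB : B →⋆ₐ[ℂ] D)
    (hιA : Function.Injective ιA) {EY : EquivBimodule C D Y} {X : Submodule ℂ Y}
    (hmor : IsMoritaIncl ⇑ιA ⇑ιB EY X) :
    ∃ (n : ℕ) (p q : Fin n → Y), (∀ i, p i ∈ X) ∧ (∀ i, q i ∈ X) ∧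
      ∑ i, EY.linn (p i) (q i) = 1 := by
  obtain ⟨s, b, hs, -, hsb⟩ := exists_unit_near_one ιA hιA _ hmor.span_XX_left
  obtain ⟨n, f, g, hfg⟩ := Submodule.mem_span_set'.1 hs
  choose z hz x hx hg using fun i => (g i).2
  refine ⟨n, fun i => EY.lsmul (ιA b) (f i • z i), x,
    fun i => hmor.lsmul_mem _ _ (X.smul_mem _ (hz i)), hx, ?_⟩
  simp only [EY.linn_lsmul_left, EY.linn_smul_left, ← hg]
  rw [← Finset.mul_sum, hfg, hsb]

end

/-- Let `A ⊆ C` and `B ⊆ D` be unital inclusions of unital C*-algebras,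
strongly Morita equivalent with respect to a `C–D`-equivalence bimodule `Y` and its
closed subspace `X`.  If `A' ∩ C = ℂ1` and `E^A : C → A`, `E^B : D → B` are conditional
expectations of Watatani index-finite type, then there is a unique conditional
expectation `E^X : Y → X` with respect to `E^A` and `E^B`. -/
theorem exists_unique_bimodule_conditional_expectation
    {A B C D Y : Type*} [CStarAlgebra A] [CStarAlgebra B] [CStarAlgebra C] [CStarAlgebra D]
    [PartialOrder A] [StarOrderedRing A] [PartialOrder B] [StarOrderedRing B]
    [PartialOrder C] [StarOrderedRing C] [PartialOrder D] [StarOrderedRing D]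
    [NormedAddCommGroup Y] [NormedSpace ℂ Y] [CompleteSpace Y]
    (ιA : A →⋆ₐ[ℂ] C) (ιB : B →⋆ₐ[ℂ] D)
    (hιA : Function.Injective ιA) (hιB : Function.Injective ιB)
    (EA : CondExpectation ιA) (EB : CondExpectation ιB)
    (hEA : FiniteIndex EA) (hEB : FiniteIndex EB)
    (hirr : IrreducibleIncl ιA)
    (EY : EquivBimodule C D Y) (X : Submodule ℂ Y)
    (hmor : IsMoritaIncl ⇑ιA ⇑ιB EY X) :
    ∃! EX : Y → Y, IsBimodCondExp ιA ιB EA EB EY X EX := by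
  obtain ⟨n, u, hu⟩ := hEB
  obtain ⟨N, z, x, hz, hx, hone⟩ := hmor.right_unit ιA ιB hιB
  obtain ⟨M, p, q, hp, hq, hone'⟩ := hmor.left_unit ιA ιB hιA
  have hD : ∀ d d' : D, (∀ w ∈ X, EY.rsmul w d = EY.rsmul w d') → d = d' := by
    intro d d' h
    have key : ∀ e : D, e = ∑ i, EY.rinn (z i) (EY.rsmul (x i) e) := by
      intro e
      simp only [EY.rinn_rsmul_right]
      rw [← Finset.sum_mul, hone, one_mul]
    rw [key d, key d']
    exact Finset.sum_congr rfl fun i _ => by rw [h _ (hx i)]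
  have hC : ∀ c c' : C, (∀ w ∈ X, EY.lsmul c w = EY.lsmul c' w) → c = c' := by
    intro c c' h
    have key : ∀ e : C, e = ∑ i, EY.linn (EY.lsmul e (p i)) (q i) := by
      intro e
      simp only [EY.linn_lsmul_left]
      rw [← Finset.mul_sum, hone', mul_one]
    rw [key c, key c']
    exact Finset.sum_congr rfl fun i _ => by rw [h _ (hp i)]
  have hexp : ∀ y : Y, ∑ i, EY.lsmul (EY.linn y (z i)) (x i) = y := by
    intro y
    simp only [EY.imprimitivity]
    rw [← EY.rsmul_sum', hone, EY.rsmul_one']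
  have hexp' : ∀ y : Y, ∑ i, EY.rsmul (p i) (EY.rinn (q i) y) = y := by
    intro y
    simp only [← EY.imprimitivity]
    rw [← EY.sum_lsmul', hone', EY.one_lsmul']
  have hsep : ∀ y y' : Y, y ∈ X → y' ∈ X → (∀ w ∈ X, EY.linn y w = EY.linn y' w) → y = y' := by
    intro y y' _ _ h
    rw [← hexp y, ← hexp y']
    exact Finset.sum_congr rfl fun i _ => by rw [h _ (hz i)]
  have hadj : ∀ (y w : Y) (d : D), EY.linn (EY.rsmul y d) w = EY.linn y (EY.rsmul w (star d)) := by
    intro y w d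
    apply hC
    intro v _
    rw [EY.imprimitivity, EY.imprimitivity, ← EY.rsmul_mul]
    congr 1
    rw [← EY.rinn_star v (EY.rsmul w (star d)), EY.rinn_rsmul_right, star_mul, star_star, EY.rinn_star]
  have hirrB : IrreducibleIncl ιB := by
    intro d hd
    set c : C := ∑ j, EY.linn (EY.rsmul (p j) d) (q j) with hc
    have hcx : ∀ w ∈ X, EY.lsmul c w = EY.rsmul w d := by
      intro w hw
      rw [hc, EY.sum_lsmul']
      conv_rhs => rw [← hexp' w, EY.sum_rsmul']
      refine Finset.sum_congr rfl fun j _ => ?_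
      obtain ⟨b, hb⟩ := hmor.rinn_mem _ (hq j) _ hw
      rw [EY.imprimitivity, ← hb, ← EY.rsmul_mul, ← EY.rsmul_mul, hd b]
    obtain ⟨t, ht⟩ := hirr c (by
      intro a
      apply hC
      intro w hw
      rw [EY.mul_lsmul, EY.mul_lsmul, hcx w hw, hcx _ (hmor.lsmul_mem a w hw),
        EY.lsmul_rsmul])
    refine ⟨t, hD _ _ fun w hw => ?_⟩
    rw [← hcx w hw, ht, EY.smul_lsmul, EY.smul_rsmul, EY.one_lsmul', EY.rsmul_one']
  set EX : Y → Y := fun y => ∑ i, EY.lsmul (ιA (EA.toFun (EY.linn y (z i)))) (x i) with hEX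
  have mem : ∀ y, EX y ∈ X := fun y =>
    X.sum_mem fun i _ => hmor.lsmul_mem _ _ (hx i)
  have map_add : ∀ y y', EX (y + y') = EX y + EX y' := by
    intro y y'
    simp only [hEX, EY.linn_add_left, EA.map_add, _root_.map_add, EY.add_lsmul,
      Finset.sum_add_distrib]
  have map_smul : ∀ (t : ℂ) y, EX (t • y) = t • EX y := by
    intro t y
    simp only [hEX, EY.linn_smul_left, EA.map_smul, _root_.map_smul, EY.smul_lsmul,
      Finset.smul_sum]
  have cond2 : ∀ (a : A) (y : Y), EX (EY.lsmul (ιA a) y) = EY.lsmul (ιA a) (EX y) := by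
    intro a y
    simp only [hEX, EY.linn_lsmul_left, EA.left_mod, map_mul, EY.mul_lsmul]
    rw [EY.lsmul_sum']
  have cond1 : ∀ (c : C), ∀ w ∈ X, EX (EY.lsmul c w) = EY.lsmul (ιA (EA.toFun c)) w := by
    intro c w hw
    conv_rhs => rw [← hexp w, EY.lsmul_sum']
    refine Finset.sum_congr rfl fun i _ => ?_
    obtain ⟨a, ha⟩ := hmor.linn_mem _ hw _ (hz i)
    rw [EY.linn_lsmul_left, ← ha, EA.right_mod, map_mul, EY.mul_lsmul]
  have cond3 : ∀ (y : Y), ∀ w ∈ X, ιA (EA.toFun (EY.linn y w)) = EY.linn (EX y) w := by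
    intro y w hw
    conv_lhs => rw [← hexp y]
    simp only [hEX]
    rw [EY.sum_linn', EY.sum_linn', EA.map_sum', _root_.map_sum]
    refine Finset.sum_congr rfl fun i _ => ?_
    obtain ⟨a, ha⟩ := hmor.linn_mem _ (hx i) _ hw
    rw [EY.linn_lsmul_left, EY.linn_lsmul_left, ← ha, EA.right_mod, map_mul]
  have cond5 : ∀ (b : B) (y : Y), EX (EY.rsmul y (ιB b)) = EY.rsmul (EX y) (ιB b) := by
    intro b y
    refine hsep _ _ (mem _) (hmor.rsmul_mem _ _ (mem _)) fun w hw => ?_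
    have hw' : EY.rsmul w (star (ιB b)) ∈ X := by
      rw [← map_star]; exact hmor.rsmul_mem _ _ hw
    rw [← cond3 _ _ hw, hadj, hadj, cond3 _ _ hw']
  have hF : ∀ d : D, ∃ b : B, ∀ w ∈ X, EX (EY.rsmul w d) = EY.rsmul w (ιB b) := by
    intro d
    choose f hf using fun i => hmor.rinn_mem _ (hz i) _ (mem (EY.rsmul (x i) d))
    refine ⟨∑ i, f i, fun w hw => ?_⟩
    rw [_root_.map_sum, EY.rsmul_sum']
    conv_lhs => rw [← hexp w, EY.sum_rsmul']
    have hsum : ∀ g : Fin N → Y, EX (∑ i, g i) = ∑ i, EX (g i) := fun g =>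
      _root_.map_sum (AddMonoidHom.mk' EX map_add) g Finset.univ
    rw [hsum]
    refine Finset.sum_congr rfl fun i _ => ?_
    obtain ⟨a, ha⟩ := hmor.linn_mem _ hw _ (hz i)
    rw [hf i, ← EY.imprimitivity, ← ha, EY.lsmul_rsmul, cond2]
  choose F hF using hF
  have hFE : ∀ d, F d = EB.toFun d := by
    refine condExp_unique_of_irreducible EB u hu hirrB F ?_ ?_ ?_ ?_
    · intro d d'
      apply hιB
      apply hD
      intro w hw
      rw [← hF _ _ hw, EY.rsmul_add, map_add, hF _ _ hw, hF _ _ hw, _root_.map_add, EY.rsmul_add]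
    · intro b d
      apply hιB
      apply hD
      intro w hw
      rw [← hF _ _ hw, EY.rsmul_mul, hF _ _ (hmor.rsmul_mem b w hw), map_mul, EY.rsmul_mul]
    · intro d b
      apply hιB
      apply hD
      intro w hw
      rw [← hF _ _ hw, EY.rsmul_mul, cond5, hF _ _ hw, map_mul, EY.rsmul_mul]
    · apply hιB
      apply hD
      intro w hw
      have h1 := cond1 1 w hw
      have h2 : EA.toFun 1 = 1 := by
        have := EA.retraction 1
        rwa [map_one] at this
      rw [h2, map_one, EY.one_lsmul'] at h1
      rw [← hF _ _ hw, EY.rsmul_one', h1, map_one, EY.rsmul_one']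
  have cond4 : ∀ (d : D), ∀ w ∈ X, EX (EY.rsmul w d) = EY.rsmul w (ιB (EB.toFun d)) := by
    intro d w hw
    rw [hF _ _ hw, hFE]
  have cond6 : ∀ (y : Y), ∀ w ∈ X, ιB (EB.toFun (EY.rinn y w)) = EY.rinn (EX y) w := by
    intro y w hw
    apply hD
    intro v hv
    rw [← cond4 _ _ hv, ← EY.imprimitivity, ← EY.imprimitivity, cond1 _ _ hw,
      ← EY.linn_star (EX y), ← cond3 _ _ hv, ← map_star, ← EA.map_star, EY.linn_star]
  refine ⟨EX, ⟨map_add, map_smul, mem, cond1, cond2, cond3, cond4, cond5, cond6⟩, ?_⟩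
  intro EX' h'
  funext y
  refine hsep _ _ (h'.mem y) (mem y) fun w hw => ?_
  rw [← h'.cond3 y w hw, cond3 y w hw]

end
end

section
/- With unital inclusions A ⊆ C, B ⊆ D, K ⊆ L of unital C*-algebras (A' ∩ C = C·1), conditional expectations E^A, E^B, E^K of Watatani index-finite type, strong Morita equivalences via (X,Y) between A ⊆ C and B ⊆ D and via (Z,W) between B ⊆ D and K ⊆ L, a quasi-basis {(v_j,v_j*)} for E^B, and the unique conditional expectations E^X: Y → X, E^Z: W → Z and E^{X⊗_B Z}: Y⊗_D W → X⊗_B Z, one has E^{X⊗_B Z}(y⊗w) = Σ_j E^X(y·v_j) ⊗ E^Z(v_j*·w) for all y ∈ Y, w ∈ W. -/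
open scoped MultiplierAlgebra

noncomputable section

section Helpers

variable {C D Y : Type*} [CStarAlgebra C] [PartialOrder C] [StarOrderedRing C]
    [CStarAlgebra D] [PartialOrder D] [StarOrderedRing D]
    [NormedAddCommGroup Y] [NormedSpace ℂ Y] [CompleteSpace Y]

theorem hlp_rinn_add_left (E : EquivBimodule C D Y) (x y z : Y) :
    E.rinn (x + y) z = E.rinn x z + E.rinn y z := by
  rw [← E.rinn_star, E.rinn_add_right, star_add, E.rinn_star, E.rinn_star]

/-- `rinn x` as an additive map. -/
def hlpR (E : EquivBimodule C D Y) (x : Y) : Y →+ D :=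
  AddMonoidHom.mk' (fun y => E.rinn x y) (E.rinn_add_right x)

/-- `rinn · y` as an additive map. -/
def hlpL (E : EquivBimodule C D Y) (y : Y) : Y →+ D :=
  AddMonoidHom.mk' (fun x => E.rinn x y) (fun a b => hlp_rinn_add_left E a b y)

/-- `lsmul · y` as an additive map. -/
def hlpM (E : EquivBimodule C D Y) (y : Y) : C →+ Y :=
  AddMonoidHom.mk' (fun c => E.lsmul c y) (fun a b => E.add_lsmul a b y)

theorem hlp_rinn_smul_left (E : EquivBimodule C D Y) (t : ℂ) (x y : Y) :
    E.rinn (t • x) y = star t • E.rinn x y := by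
  rw [← E.rinn_star, E.rinn_smul_right, star_smul, E.rinn_star]

theorem hlp_rinn_rsmul_left (E : EquivBimodule C D Y) (x y : Y) (d : D) :
    E.rinn (E.rsmul x d) y = star d * E.rinn x y := by
  rw [← E.rinn_star, E.rinn_rsmul_right, star_mul, E.rinn_star]

theorem hlp_span_top (E : EquivBimodule C D Y) (c : C) :
    c ∈ Submodule.span ℂ {c : C | ∃ x y, c = E.linn x y} := by
  set I := Submodule.span ℂ {c : C | ∃ x y, c = E.linn x y} with hI
  have hmul : ∀ a : C, ∀ b ∈ I, a * b ∈ I := by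
    intro a b hb
    induction hb using Submodule.span_induction with
    | mem b hb =>
      obtain ⟨x, y, rfl⟩ := hb
      exact Submodule.subset_span ⟨E.lsmul a x, y, (E.linn_lsmul_left a x y).symm⟩
    | zero => rw [mul_zero]; exact I.zero_mem
    | add x y _ _ hx hy => rw [mul_add]; exact I.add_mem hx hy
    | smul t x _ hx => rw [mul_smul_comm]; exact I.smul_mem t hx
  obtain ⟨b, hbu, hbI⟩ := E.full_left.inter_open_nonempty {b : C | IsUnit b}
    Units.isOpen ⟨1, isUnit_one⟩
  obtain ⟨u, rfl⟩ := hbu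
  have := hmul (c * (↑u⁻¹ : C)) u hbI
  rwa [mul_assoc, Units.inv_mul, mul_one] at this

theorem hlp_adj (E : EquivBimodule C D Y) (c : C) (w w' : Y) :
    E.rinn (E.lsmul c w) w' = E.rinn w (E.lsmul (star c) w') := by
  have hc := hlp_span_top E c
  induction hc using Submodule.span_induction with
  | mem b hb =>
    obtain ⟨x, y, rfl⟩ := hb
    rw [E.linn_star, E.imprimitivity, E.imprimitivity, hlp_rinn_rsmul_left,
      E.rinn_rsmul_right, E.rinn_star]
  | zero =>
    have h0 : ∀ y, E.lsmul 0 y = 0 := fun y => (hlpM E y).map_zero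
    rw [star_zero, h0, h0]
    exact ((hlpL E w').map_zero).trans ((hlpR E w).map_zero).symm
  | add a b _ _ ha hb =>
    rw [E.add_lsmul, star_add, E.add_lsmul, hlp_rinn_add_left, ha, hb, E.rinn_add_right]
  | smul t a _ ha =>
    rw [E.smul_lsmul, star_smul, E.smul_lsmul, hlp_rinn_smul_left, ha, E.rinn_smul_right]

/-- An element of the closed span orthogonal to the spanning set vanishes. -/
theorem hlp_zero (E : EquivBimodule C D Y) (T : Set Y) (u : Y)
    (hu : u ∈ closure (Submodule.span ℂ T : Set Y)) (h : ∀ t ∈ T, E.rinn u t = 0) :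
    u = 0 := by
  have h' : ∀ t ∈ Submodule.span ℂ T, E.rinn u t = 0 := by
    intro t ht
    induction ht using Submodule.span_induction with
    | mem b hb => exact h b hb
    | zero => exact (hlpR E u).map_zero
    | add a b _ _ ha hb => rw [E.rinn_add_right, ha, hb, add_zero]
    | smul t a _ ha => rw [E.rinn_smul_right, ha, smul_zero]
  have key : ∀ t ∈ Submodule.span ℂ T, ‖u‖ ≤ ‖u - t‖ := by
    intro t ht
    have e1 : E.rinn t u = 0 := by rw [← E.rinn_star, h' t ht, star_zero]
    have e2 : E.rinn (u - t) (u - t) = E.rinn u u + E.rinn t t := by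
      have a1 : E.rinn (u - t) (u - t) = E.rinn (u - t) u - E.rinn (u - t) t :=
        (hlpR E (u - t)).map_sub u t
      have a2 : ∀ z, E.rinn (u - t) z = E.rinn u z - E.rinn t z :=
        fun z => (hlpL E z).map_sub u t
      rw [a1, a2, a2, h' t ht, e1]; abel
    have e3 : ‖E.rinn u u‖ ≤ ‖E.rinn (u - t) (u - t)‖ := by
      apply CStarAlgebra.norm_le_norm_of_nonneg_of_le (E.rinn_nonneg u)
      rw [e2]; exact le_add_of_nonneg_right (E.rinn_nonneg t)
    rw [E.norm_rinn, E.norm_rinn] at e3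
    exact le_of_sq_le_sq e3 (norm_nonneg _)
  rw [← norm_le_zero_iff]
  apply le_of_forall_pos_le_add
  intro ε hε
  obtain ⟨t, ht, hd⟩ := Metric.mem_closure_iff.1 hu ε hε
  rw [dist_eq_norm] at hd
  linarith [key t ht]

end Helpers

/-- With strongly Morita equivalent unital inclusions `A ⊆ C`, `B ⊆ D`,
`K ⊆ L` (via `(X,Y)` and `(Z,W)`), `A' ∩ C = ℂ1`, conditional expectations `E^A`,
`E^B`, `E^K` of index-finite type, a quasi-basis `{(v_j, v_j*)}` for `E^B`, and the
unique conditional expectations `E^X`, `E^Z`, `E^{X⊗_B Z}`, one has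
`E^{X⊗_B Z}(y ⊗ w) = Σ_j E^X(y·v_j) ⊗ E^Z(v_j*·w)`. -/
theorem tensor_conditional_expectation_formula
    {A B K C D L Y W V : Type*}
    [CStarAlgebra A] [CStarAlgebra B] [CStarAlgebra K]
    [CStarAlgebra C] [CStarAlgebra D] [CStarAlgebra L]
    [PartialOrder A] [StarOrderedRing A] [PartialOrder B] [StarOrderedRing B]
    [PartialOrder K] [StarOrderedRing K] [PartialOrder C] [StarOrderedRing C]
    [PartialOrder D] [StarOrderedRing D] [PartialOrder L] [StarOrderedRing L]
    [NormedAddCommGroup Y] [NormedSpace ℂ Y] [CompleteSpace Y]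
    [NormedAddCommGroup W] [NormedSpace ℂ W] [CompleteSpace W]
    [NormedAddCommGroup V] [NormedSpace ℂ V] [CompleteSpace V]
    (ιA : A →⋆ₐ[ℂ] C) (ιB : B →⋆ₐ[ℂ] D) (ιK : K →⋆ₐ[ℂ] L)
    (hιA : Function.Injective ιA) (hιB : Function.Injective ιB)
    (hιK : Function.Injective ιK)
    (EA : CondExpectation ιA) (EB : CondExpectation ιB) (EK : CondExpectation ιK)
    (hEA : FiniteIndex EA) (hEK : FiniteIndex EK)
    (hirr : IrreducibleIncl ιA)
    {n : ℕ} (v : Fin n → D) (hv : IsQuasiBasis EB v)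
    (EY : EquivBimodule C D Y) (X : Submodule ℂ Y) (hmorY : IsMoritaIncl ⇑ιA ⇑ιB EY X)
    (EW : EquivBimodule D L W) (Z : Submodule ℂ W) (hmorW : IsMoritaIncl ⇑ιB ⇑ιK EW Z)
    (EX : Y → Y) (hEX : IsBimodCondExp ιA ιB EA EB EY X EX)
    (EZ : W → W) (hEZ : IsBimodCondExp ιB ιK EB EK EW Z EZ)
    (G : EquivBimodule C L V) (s : Y → W → V) (hG : IsTensorProd EY EW G s)
    (S : Submodule ℂ V)
    (hS : (S : Set V) =
      closure (Submodule.span ℂ {v' : V | ∃ x ∈ X, ∃ z ∈ Z, v' = s x z} : Set V))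
    (EXZ : V → V) (hEXZ : IsBimodCondExp ιA ιK EA EK G S EXZ) :
    ∀ (y : Y) (w : W),
      EXZ (s y w) = ∑ j, s (EX (EY.rsmul y (v j))) (EZ (EW.lsmul (star (v j)) w)) := by
  intro y w
  have hsS : ∀ x ∈ X, ∀ z ∈ Z, s x z ∈ S := by
    intro x hx z hz
    have : s x z ∈ (S : Set V) := by
      rw [hS]; exact subset_closure (Submodule.subset_span ⟨x, hx, z, hz, rfl⟩)
    exact this
  rw [← sub_eq_zero]
  set R := ∑ j, s (EX (EY.rsmul y (v j))) (EZ (EW.lsmul (star (v j)) w)) with hR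
  have hmem : EXZ (s y w) - R ∈ S :=
    S.sub_mem (hEXZ.mem _) (S.sum_mem fun j _ => hsS _ (hEX.mem _) _ (hEZ.mem _))
  refine hlp_zero G {v' : V | ∃ x ∈ X, ∃ z ∈ Z, v' = s x z} _ (hS ▸ hmem) ?_
  rintro _ ⟨x, hx, z, hz, rfl⟩
  have hsub : G.rinn (EXZ (s y w) - R) (s x z)
      = G.rinn (EXZ (s y w)) (s x z) - G.rinn R (s x z) :=
    (hlpL G (s x z)).map_sub _ _
  have hsum : G.rinn R (s x z) = ∑ j, G.rinn
      (s (EX (EY.rsmul y (v j))) (EZ (EW.lsmul (star (v j)) w))) (s x z) :=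
    map_sum (hlpL G (s x z)) _ _
  have hterm : ∀ j, G.rinn
      (s (EX (EY.rsmul y (v j))) (EZ (EW.lsmul (star (v j)) w))) (s x z)
      = ιK (EK.toFun (EW.rinn w (EW.lsmul
          (v j * ιB (EB.toFun (star (v j) * EY.rinn y x))) z))) := by
    intro j
    rw [hG.map_rinn, ← hEX.cond6 _ x hx, ← hEZ.cond6 _ _ (hmorW.lsmul_mem _ z hz),
      hlp_adj, star_star, hlp_rinn_rsmul_left, EW.mul_lsmul]
  let EKh : L →+ K := AddMonoidHom.mk' EK.toFun EK.map_add
  have hfin : ∑ j, ιK (EK.toFun (EW.rinn w (EW.lsmul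
          (v j * ιB (EB.toFun (star (v j) * EY.rinn y x))) z)))
      = ιK (EK.toFun (EW.rinn w (EW.lsmul
          (∑ j, v j * ιB (EB.toFun (star (v j) * EY.rinn y x))) z))) :=
    (map_sum ((AddMonoidHom.mk' ιK (map_add ιK)).comp (EKh.comp ((hlpR EW w).comp (hlpM EW z)))) _ _).symm
  rw [hsub, hsum, Finset.sum_congr rfl fun j _ => hterm j, hfin, (hv (EY.rinn y x)).1,
    ← hEXZ.cond6 _ _ (hsS x hx z hz), hG.map_rinn, sub_self]

end
end

section
/- In the setting of iterated strongly Morita equivalent unital inclusions A ⊆ C, B ⊆ D, K ⊆ L with A' ∩ C = C·1 and conditional expectations E^A, E^B, E^K of Watatani index-finite type: let Φ be the C_1–L_1-equivalence bimodule isomorphism of Y_1⊗_{D_1}W_1 onto (Y⊗_D W)_1 given by Φ(c⊗x⊗d̃⊗d'⊗z⊗l̃) = c⊗x⊗E^B(d*d')·z⊗l̃, and let φ_Y, φ_W, φ_{Y⊗_D W} be the canonical embeddings of Y, W, Y⊗_D W into their upward basic constructions. Then φ_{Y⊗_D W} = Φ ∘ (φ_Y ⊗ φ_W). -/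
open scoped MultiplierAlgebra

noncomputable section

theorem sum_of_add {ι M N : Type*} [AddCommGroup M] [AddCommGroup N] (f : M → N)
    (hf : ∀ x y, f (x + y) = f x + f y) (t : Finset ι) (g : ι → M) :
    f (∑ i ∈ t, g i) = ∑ i ∈ t, f (g i) :=
  map_sum (AddMonoidHom.mk' f hf) g t

theorem recon {A B C D Y : Type*} [CStarAlgebra A] [CStarAlgebra B] [CStarAlgebra C]
    [CStarAlgebra D] [PartialOrder C] [StarOrderedRing C] [PartialOrder D] [StarOrderedRing D]
    [PartialOrder A] [StarOrderedRing A] [PartialOrder B] [StarOrderedRing B]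
    [NormedAddCommGroup Y] [NormedSpace ℂ Y] [CompleteSpace Y]
    (ιA : A →⋆ₐ[ℂ] C) (ιB : B →⋆ₐ[ℂ] D)
    (EA : CondExpectation ιA) (EB : CondExpectation ιB) {n : ℕ} (u : Fin n → C)
    (hu : IsQuasiBasis EA u)
    (EY : EquivBimodule C D Y) (X : Submodule ℂ Y) (hm : IsMoritaIncl ⇑ιA ⇑ιB EY X)
    (EX : Y → Y) (hEX : IsBimodCondExp ιA ιB EA EB EY X EX) (y : Y) :
    ∑ i, EY.lsmul (u i) (EX (EY.lsmul (star (u i)) y)) = y := by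
  set y' := ∑ i, EY.lsmul (u i) (EX (EY.lsmul (star (u i)) y)) with hy'
  have h1 : ∀ x ∈ X, EY.linn y' x = EY.linn y x := by
    intro x hx
    rw [hy', sum_of_add (fun a => EY.linn a x) (fun a b => EY.linn_add_left a b x)]
    rw [← (hu (EY.linn y x)).1]
    refine Finset.sum_congr rfl fun i _ => ?_
    rw [EY.linn_lsmul_left, ← hEX.cond3 _ x hx, EY.linn_lsmul_left]
  have h2 : ∀ x ∈ X, EY.linn (y' - y) x = 0 := by
    intro x hx
    have := EY.linn_add_left (y' - y) y x
    rw [sub_add_cancel, h1 x hx] at this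
    simpa using this
  have h0 : ∀ z, EY.lsmul 0 z = 0 := by
    intro z
    have := EY.smul_lsmul 0 0 z
    simpa using this
  have h00 : EY.rinn (y' - y) 0 = 0 := by
    have := EY.rinn_smul_right 0 (y' - y) 0
    simpa using this
  have h3 : ∀ x ∈ X, ∀ z ∈ X, EY.rinn (y' - y) (y' - y) * EY.rinn x z = 0 := by
    intro x hx z hz
    rw [← EY.rinn_rsmul_right, ← EY.imprimitivity, h2 x hx, h0, h00]
  set p := EY.rinn (y' - y) (y' - y) with hp
  have hcl : IsClosed {d : D | p * d = 0} :=
    isClosed_eq (continuous_const.mul continuous_id) continuous_const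
  have hsub : (Submodule.span ℂ {d : D | ∃ x ∈ X, ∃ y ∈ X, d = EY.rinn x y} : Set D)
      ⊆ {d : D | p * d = 0} := by
    intro d hd
    induction hd using Submodule.span_induction with
    | mem d h =>
      obtain ⟨x, hx, z, hz, rfl⟩ := h
      exact h3 x hx z hz
    | zero => simp
    | add a b _ _ ha hb =>
      simp only [Set.mem_setOf_eq] at ha hb ⊢
      rw [mul_add, ha, hb, add_zero]
    | smul c a _ ha =>
      simp only [Set.mem_setOf_eq] at ha ⊢
      rw [mul_smul_comm, ha, smul_zero]
  have h4 : (1 : D) ∈ {d : D | p * d = 0} := by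
    apply closure_minimal hsub hcl
    rw [hm.span_XX_right]
    exact ⟨1, map_one ιB⟩
  have h5 : p = 0 := by simpa using h4
  exact sub_eq_zero.mp (EY.rinn_definite _ h5)

/-- In the setting of iterated strongly Morita equivalent unital inclusions
with conditional expectations of index-finite type, the isomorphism
`Φ : Y₁ ⊗_{D₁} W₁ → (Y ⊗_D W)₁` of Lemma 4.4 intertwines the canonical embeddings:
`φ_{Y⊗_D W} = Φ ∘ (φ_Y ⊗ φ_W)`. -/
theorem embedding_compatible_with_upward_iso
    {A B K C D L C₁ D₁ L₁ Y W V T₁ T₂ VG TH : Type*}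
    [CStarAlgebra A] [CStarAlgebra B] [CStarAlgebra K]
    [CStarAlgebra C] [CStarAlgebra D] [CStarAlgebra L]
    [CStarAlgebra C₁] [CStarAlgebra D₁] [CStarAlgebra L₁]
    [PartialOrder A] [StarOrderedRing A] [PartialOrder B] [StarOrderedRing B]
    [PartialOrder K] [StarOrderedRing K] [PartialOrder C] [StarOrderedRing C]
    [PartialOrder D] [StarOrderedRing D] [PartialOrder L] [StarOrderedRing L]
    [PartialOrder C₁] [StarOrderedRing C₁] [PartialOrder D₁] [StarOrderedRing D₁]
    [PartialOrder L₁] [StarOrderedRing L₁]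
    [NormedAddCommGroup Y] [NormedSpace ℂ Y] [CompleteSpace Y]
    [NormedAddCommGroup W] [NormedSpace ℂ W] [CompleteSpace W]
    [NormedAddCommGroup V] [NormedSpace ℂ V] [CompleteSpace V]
    [NormedAddCommGroup T₁] [NormedSpace ℂ T₁] [CompleteSpace T₁]
    [NormedAddCommGroup T₂] [NormedSpace ℂ T₂] [CompleteSpace T₂]
    [NormedAddCommGroup VG] [NormedSpace ℂ VG] [CompleteSpace VG]
    [NormedAddCommGroup TH] [NormedSpace ℂ TH] [CompleteSpace TH]
    (ιA : A →⋆ₐ[ℂ] C) (ιB : B →⋆ₐ[ℂ] D) (ιK : K →⋆ₐ[ℂ] L)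
    (hιA : Function.Injective ιA) (hιB : Function.Injective ιB)
    (hιK : Function.Injective ιK)
    (EA : CondExpectation ιA) (EB : CondExpectation ιB) (EK : CondExpectation ιK)
    (hirr : IrreducibleIncl ιA)
    -- quasi-bases for `E^A`, `E^B`, `E^K`
    {nA nB nK : ℕ} (u : Fin nA → C) (hu : IsQuasiBasis EA u)
    (v : Fin nB → D) (hv : IsQuasiBasis EB v)
    (sb : Fin nK → L) (hsb : IsQuasiBasis EK sb)
    -- the C*-basic constructions
    (ιC : C →⋆ₐ[ℂ] C₁) (eA : C₁) (hbcC : IsBasicConstruction ιA EA ιC eA)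
    (ιD : D →⋆ₐ[ℂ] D₁) (eB : D₁) (hbcD : IsBasicConstruction ιB EB ιD eB)
    (ιL : L →⋆ₐ[ℂ] L₁) (eK : L₁) (hbcL : IsBasicConstruction ιK EK ιL eK)
    -- the strong Morita equivalences
    (EY : EquivBimodule C D Y) (X : Submodule ℂ Y) (hmorY : IsMoritaIncl ⇑ιA ⇑ιB EY X)
    (EW : EquivBimodule D L W) (Z : Submodule ℂ W) (hmorW : IsMoritaIncl ⇑ιB ⇑ιK EW Z)
    [CompleteSpace X] (MX : EquivBimodule A B X) (hMX : IsRestriction ⇑ιA ⇑ιB EY X MX)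
    [CompleteSpace Z] (MZ : EquivBimodule B K Z) (hMZ : IsRestriction ⇑ιB ⇑ιK EW Z MZ)
    -- the (unique) conditional expectations `E^X`, `E^Z`
    (EX : Y → Y) (hEX : IsBimodCondExp ιA ιB EA EB EY X EX)
    (EZ : W → W) (hEZ : IsBimodCondExp ιB ιK EB EK EW Z EZ)
    -- the tensor product `Y ⊗_D W` and its subspace `X ⊗_B Z`
    (G : EquivBimodule C L V) (s : Y → W → V) (hG : IsTensorProd EY EW G s)
    (S : Submodule ℂ V)
    (hS : (S : Set V) =
      closure (Submodule.span ℂ {v' : V | ∃ x ∈ X, ∃ z ∈ Z, v' = s x z} : Set V))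
    [CompleteSpace S] (MS : EquivBimodule A K S) (hMS : IsRestriction ⇑ιA ⇑ιK G S MS)
    (hmemS : ∀ (x : X) (b : B) (z : Z), s (x : Y) (EW.lsmul (ιB b) (z : W)) ∈ S)
    (EXZ : V → V) (hEXZ : IsBimodCondExp ιA ιK EA EK G S EXZ)
    -- the upward basic constructions `Y₁`, `W₁` and `(Y ⊗_D W)₁`
    (F₁ : EquivBimodule C₁ D₁ T₁) (t₁ : C → X → D → T₁)
    (hF₁ : IsUpwardBasic ιA ιB EA EB MX ιC eA ιD eB F₁ t₁)
    (F₂ : EquivBimodule D₁ L₁ T₂) (t₂ : D → Z → L → T₂)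
    (hF₂ : IsUpwardBasic ιB ιK EB EK MZ ιD eB ιL eK F₂ t₂)
    (G₁ : EquivBimodule C₁ L₁ VG) (r : C → S → L → VG)
    (hG₁ : IsUpwardBasic ιA ιK EA EK MS ιC eA ιL eK G₁ r)
    -- a realization of the tensor product `Y₁ ⊗_{D₁} W₁`
    (H : EquivBimodule C₁ L₁ TH) (q : T₁ → T₂ → TH) (hH : IsTensorProd F₁ F₂ H q)
    -- the isomorphism `Φ` of Lemma 4.4
    (Φ : H.Iso G₁)
    (hΦ : ∀ (c : C) (x : X) (d d' : D) (z : Z) (l : L),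
      Φ.toEquiv (q (t₁ c x d) (t₂ d' z l)) =
        r c ⟨s (x : Y) (EW.lsmul (ιB (EB.toFun (star d * d'))) (z : W)),
          hmemS x (EB.toFun (star d * d')) z⟩ l) :
    -- `φ_{Y⊗_D W} = Φ ∘ (φ_Y ⊗ φ_W)`
    ∀ (y : Y) (w : W),
      (∑ i, ∑ l, r (u i)
          ⟨EXZ (G.lsmul (star (u i)) (G.rsmul (s y w) (sb l))), hEXZ.mem _⟩ (sb l)) =
        Φ.toEquiv (q
          (∑ i, ∑ j, t₁ (u i)
            ⟨EX (EY.lsmul (star (u i)) (EY.rsmul y (v j))), hEX.mem _⟩ (v j))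
          (∑ j, ∑ l, t₂ (v j)
            ⟨EZ (EW.lsmul (star (v j)) (EW.rsmul w (sb l))), hEZ.mem _⟩ (sb l))) := by
  intro y w
  have hqs := fun (i : Fin nA) (j j' : Fin nB) (l : Fin nK) =>
    hΦ (u i) ⟨EX (EY.lsmul (star (u i)) (EY.rsmul y (v j))), hEX.mem _⟩ (v j) (v j')
      ⟨EZ (EW.lsmul (star (v j')) (EW.rsmul w (sb l))), hEZ.mem _⟩ (sb l)
  have hSmem : ∀ x ∈ X, ∀ z ∈ Z, s x z ∈ S := by
    intro x hx z hz
    have : s x z ∈ (S : Set V) := by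
      rw [hS]
      exact subset_closure (Submodule.subset_span ⟨x, hx, z, hz, rfl⟩)
    exact this
  have hs1 : ∀ {ι : Type} (t : Finset ι) (g : ι → Y) (w : W),
      s (∑ i ∈ t, g i) w = ∑ i ∈ t, s (g i) w := fun t g w =>
    sum_of_add (fun a => s a w) (fun a b => hG.add_left a b w) t g
  have hs2 : ∀ {ι : Type} (t : Finset ι) (g : ι → W) (y : Y),
      s y (∑ i ∈ t, g i) = ∑ i ∈ t, s y (g i) := fun t g y =>
    sum_of_add (fun a => s y a) (fun a b => hG.add_right y a b) t g
  -- `E^{X ⊗ Z} (y ⊗ z) = E^X y ⊗ z`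
  have hE1 : ∀ (y : Y), ∀ z ∈ Z, EXZ (s y z) = s (EX y) z := by
    intro y z hz
    rw [← recon ιA ιB EA EB u hu EY X hmorY EX hEX y, hs1,
      sum_of_add EXZ hEXZ.map_add, sum_of_add EX hEX.map_add, hs1]
    refine Finset.sum_congr rfl fun i _ => ?_
    rw [← hG.map_lsmul, hEXZ.cond1 _ _ (hSmem _ (hEX.mem _) z hz), hG.map_lsmul,
      hEX.cond1 _ _ (hEX.mem _)]
  have hE2 : ∀ (y : Y) (w : W),
      EXZ (s y w) = ∑ j, s (EX (EY.rsmul y (v j))) (EZ (EW.lsmul (star (v j)) w)) := by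
    intro y w
    conv_lhs => rw [← recon ιB ιK EB EK v hv EW Z hmorW EZ hEZ w]
    rw [hs2, sum_of_add EXZ hEXZ.map_add]
    refine Finset.sum_congr rfl fun j _ => ?_
    rw [← hG.balanced, hE1 _ _ (hEZ.mem _)]
  have hB : ∀ (j : Fin nB) (w : W),
      ∑ j', EW.lsmul (ιB (EB.toFun (star (v j) * v j'))) (EZ (EW.lsmul (star (v j')) w)) =
        EZ (EW.lsmul (star (v j)) w) := by
    intro j w
    conv_rhs => rw [← (hv (star (v j))).2]
    rw [sum_of_add (fun d => EW.lsmul d w) (fun a b => EW.add_lsmul a b w),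
      sum_of_add EZ hEZ.map_add]
    refine Finset.sum_congr rfl fun j' _ => ?_
    rw [EW.mul_lsmul, hEZ.cond2]
  -- expand the right-hand side
  have hq1 : ∀ {ι : Type} (t : Finset ι) (g : ι → T₁) (b : T₂),
      q (∑ i ∈ t, g i) b = ∑ i ∈ t, q (g i) b := fun t g w =>
    sum_of_add (fun a => q a w) (fun a b => hH.add_left a b w) t g
  have hq2 : ∀ {ι : Type} (t : Finset ι) (g : ι → T₂) (a : T₁),
      q a (∑ i ∈ t, g i) = ∑ i ∈ t, q a (g i) := fun t g y =>
    sum_of_add (fun a => q y a) (fun a b => hH.add_right y a b) t g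
  simp only [hq1, hq2, map_sum, hqs]
  refine Finset.sum_congr rfl fun i _ => ?_
  have hr : ∀ {ι : Type} (t : Finset ι) (g : ι → S) (c : C) (l : L),
      ∑ i ∈ t, r c (g i) l = r c (∑ i ∈ t, g i) l := fun t g c l =>
    (sum_of_add (fun a => r c a l) (fun a b => hG₁.add₂ c a b l) t g).symm
  have hcomm : ∀ f : Fin nB → Fin nB → Fin nK → VG,
      ∑ j, ∑ j', ∑ l, f j j' l = ∑ l, ∑ j, ∑ j', f j j' l := by
    intro f
    rw [Finset.sum_comm]
    simp_rw [Finset.sum_comm (s := (Finset.univ : Finset (Fin nB)))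
      (t := (Finset.univ : Finset (Fin nK)))]
    refine Finset.sum_congr rfl fun l _ => ?_
    rw [Finset.sum_comm]
  rw [hcomm]
  refine Finset.sum_congr rfl fun l _ => ?_
  simp only [hr]
  congr 1
  apply Subtype.ext
  simp only [AddSubmonoidClass.coe_finset_sum]
  rw [hG.map_rsmul, hG.map_lsmul, hE2]
  refine Finset.sum_congr rfl fun j _ => ?_
  rw [← hs2, hB, EY.lsmul_rsmul]

end
end
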